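/- For a ring R the following conditions are equivalent: (1) R is a prime rich ring; (2) every ideal 𝔞 of R contains a finite product of its minimal primes (primes minimal over 𝔞); (3) for every ideal 𝔞 of R, the set min(𝔞) of prime ideals minimal over 𝔞 is finite and the prime radical 𝔫_{R/𝔞} of the factor ring R/𝔞 is a nilpotent ideal. -/

import Mathlib

/- Common framework: two-sided ideals, prime ideals, denominator sets and
   left localizations of (possibly noncommutative) rings, described
   axiomatically via their characteristic properties. -/

namespace BavulaMinPrimes

/-- A subset of a ring is a two-sided ideal. -/
def IsIdealSet {R : Type*} [Ring R] (I : Set R) : Prop :=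
  (0 : R) ∈ I ∧ (∀ a ∈ I, ∀ b ∈ I, a + b ∈ I) ∧ (∀ a ∈ I, -a ∈ I) ∧
    ∀ a ∈ I, ∀ r : R, r * a ∈ I ∧ a * r ∈ I

/-- A (two-sided) prime ideal: a proper ideal `P` such that `A * B ⊆ P`
implies `A ⊆ P` or `B ⊆ P` for all ideals `A`, `B`. -/
def IsPrimeIdealSet {R : Type*} [Ring R] (P : Set R) : Prop :=
  IsIdealSet P ∧ P ≠ Set.univ ∧
    ∀ A B : Set R, IsIdealSet A → IsIdealSet B →
      (∀ a ∈ A, ∀ b ∈ B, a * b ∈ P) → A ⊆ P ∨ B ⊆ P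

/-- A completely prime ideal: the factor ring is a domain. -/
def IsCompletelyPrimeIdealSet {R : Type*} [Ring R] (P : Set R) : Prop :=
  IsIdealSet P ∧ P ≠ Set.univ ∧ ∀ a b : R, a * b ∈ P → a ∈ P ∨ b ∈ P

/-- A minimal prime ideal of a ring. -/
def IsMinimalPrimeIdealSet {R : Type*} [Ring R] (P : Set R) : Prop :=
  IsPrimeIdealSet P ∧ ∀ P' : Set R, IsPrimeIdealSet P' → P' ⊆ P → P' = P

/-- A prime minimal over an ideal `A`. -/
def IsMinimalPrimeOver {R : Type*} [Ring R] (A P : Set R) : Prop :=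
  IsPrimeIdealSet P ∧ A ⊆ P ∧
    ∀ P' : Set R, IsPrimeIdealSet P' → A ⊆ P' → P' ⊆ P → P' = P

/-- The set `min(R)` of minimal primes of `R`. -/
def minPrimes (R : Type*) [Ring R] : Set (Set R) := { P | IsMinimalPrimeIdealSet P }

/-- The prime radical: intersection of all prime ideals. -/
def primeRadicalSet (R : Type*) [Ring R] : Set R :=
  { r : R | ∀ P : Set R, IsPrimeIdealSet P → r ∈ P }

/-- A ring is semiprime if its prime radical is zero. -/
def IsSemiprimeRing (R : Type*) [Ring R] : Prop := primeRadicalSet R = {0}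

/-- A ring is prime if its zero ideal is a prime ideal. -/
def IsPrimeRing (R : Type*) [Ring R] : Prop := IsPrimeIdealSet ({0} : Set R)

/-- A multiplicative subset: `1 ∈ S`, `0 ∉ S`, closed under multiplication. -/
def IsMulSet {R : Type*} [Ring R] (S : Set R) : Prop :=
  (1 : R) ∈ S ∧ (0 : R) ∉ S ∧ ∀ s ∈ S, ∀ t ∈ S, s * t ∈ S

/-- The left Ore condition: `S r ∩ R s ≠ ∅`. -/
def LeftOre {R : Type*} [Ring R] (S : Set R) : Prop :=
  ∀ r : R, ∀ s ∈ S, ∃ s' ∈ S, ∃ r' : R, s' * r = r' * s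

/-- The right Ore condition: `r S ∩ s R ≠ ∅`. -/
def RightOre {R : Type*} [Ring R] (S : Set R) : Prop :=
  ∀ r : R, ∀ s ∈ S, ∃ s' ∈ S, ∃ r' : R, r * s' = s * r'

/-- A left denominator set: a left Ore multiplicative set such that
`r s = 0` (with `s ∈ S`) implies `t r = 0` for some `t ∈ S`. -/
def IsLeftDenominatorSet {R : Type*} [Ring R] (S : Set R) : Prop :=
  IsMulSet S ∧ LeftOre S ∧ ∀ r : R, ∀ s ∈ S, r * s = 0 → ∃ t ∈ S, t * r = 0

/-- A right denominator set. -/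
def IsRightDenominatorSet {R : Type*} [Ring R] (S : Set R) : Prop :=
  IsMulSet S ∧ RightOre S ∧ ∀ r : R, ∀ s ∈ S, s * r = 0 → ∃ t ∈ S, r * t = 0

/-- `ass_l(S) = { r | s r = 0 for some s ∈ S }`. -/
def lAss {R : Type*} [Ring R] (S : Set R) : Set R := { r : R | ∃ s ∈ S, s * r = 0 }

/-- `f : R →+* Q` realizes `Q` as the left localization `S⁻¹R`:
elements of `S` become units, every element of `Q` is a left fraction
`(f s)⁻¹ (f r)`, and the kernel of `f` is `ass_l(S)`.  These properties
characterize `S⁻¹R` up to a unique `R`-isomorphism. -/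
structure IsLeftLocalization {R Q : Type*} [Ring R] [Ring Q]
    (S : Set R) (f : R →+* Q) : Prop where
  isUnit : ∀ s ∈ S, IsUnit (f s)
  surj : ∀ q : Q, ∃ s ∈ S, ∃ r : R, f s * q = f r
  ker : ∀ r : R, f r = 0 ↔ r ∈ lAss S

/-- `S⁻¹I = { s⁻¹ a | s ∈ S, a ∈ I }` as a subset of the localization `Q`:
`q ∈ S⁻¹I` iff `f s * q = f a` for some `s ∈ S`, `a ∈ I`. -/
def locSet {R Q : Type*} [Ring R] [Ring Q] (f : R →+* Q) (S : Set R)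
    (I : Set R) : Set Q :=
  { q : Q | ∃ s ∈ S, ∃ a ∈ I, f s * q = f a }

/-- A normal element: `R n = n R`. -/
def IsNormalElement {R : Type*} [Ring R] (n : R) : Prop :=
  (∀ r : R, ∃ r' : R, r * n = n * r') ∧ ∀ r : R, ∃ r' : R, n * r = r' * n

/-- A prime rich ring: every ideal contains a finite product of prime ideals
containing it (the empty product being the whole ring). -/
def IsPrimeRich (R : Type*) [Ring R] : Prop :=
  ∀ A : Set R, IsIdealSet A →
    ∃ (n : ℕ) (P : Fin n → Set R),
      (∀ i, IsPrimeIdealSet (P i) ∧ A ⊆ P i) ∧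
      ∀ x : Fin n → R, (∀ i, x i ∈ P i) → (List.ofFn x).prod ∈ A

/-- An ideal which is finitely generated as a right `R`-module. -/
def IsFGRightIdeal {R : Type*} [Ring R] (I : Set R) : Prop :=
  ∃ (m : ℕ) (g : Fin m → R), (∀ i, g i ∈ I) ∧
    ∀ x ∈ I, ∃ c : Fin m → R, x = ∑ i, g i * c i

theorem IsPrimeIdealSet.one_notMem {R : Type*} [Ring R] {P : Set R} (hP : IsPrimeIdealSet P) :
    (1 : R) ∉ P := fun h =>
  hP.2.1 (Set.eq_univ_of_forall fun r => by simpa using (hP.1.2.2.2 1 h r).1)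

theorem IsPrimeIdealSet.mem_or_mem {R : Type*} [Ring R] {P : Set R} (hP : IsPrimeIdealSet P)
    {a b : R} (h : ∀ r, a * r * b ∈ P) : a ∈ P ∨ b ∈ P := by
  obtain ⟨⟨h0, hadd, hneg, hmul⟩, -, hprime⟩ := hP
  let B : Set R := {y | ∀ r, a * r * y ∈ P}
  let A : Set R := {x | ∀ r, ∀ y ∈ B, x * r * y ∈ P}
  have hB : IsIdealSet B := by
    refine ⟨fun r => by simpa using h0, fun x hx y hy r => ?_, fun x hx r => ?_,
      fun x hx s => ⟨fun r => ?_, fun r => ?_⟩⟩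
    · simpa [mul_add] using hadd _ (hx r) _ (hy r)
    · simpa using hneg _ (hx r)
    · simpa [mul_assoc] using hx (r * s)
    · simpa [mul_assoc] using (hmul _ (hx r) s).2
  have hA : IsIdealSet A := by
    refine ⟨fun r y _ => by simpa using h0, fun x hx z hz r y hy => ?_, fun x hx r y hy => ?_,
      fun x hx s => ⟨fun r y hy => ?_, fun r y hy => ?_⟩⟩
    · simpa [add_mul] using hadd _ (hx r y hy) _ (hz r y hy)
    · simpa using hneg _ (hx r y hy)
    · simpa [mul_assoc] using (hmul _ (hx r y hy) s).1
    · simpa [mul_assoc] using hx (s * r) y hy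
  rcases hprime A B hA hB fun x hx y hy => by simpa using hx 1 y hy with hAP | hBP
  · exact Or.inl (hAP fun r y hy => hy r)
  · exact Or.inr (hBP h)

theorem IsIdealSet.isPrimeIdealSet {R : Type*} [Ring R] {P : Set R} (hP : IsIdealSet P)
    (h1 : (1 : R) ∉ P) (h : ∀ a b, (∀ r, a * r * b ∈ P) → a ∈ P ∨ b ∈ P) :
    IsPrimeIdealSet P := by
  refine ⟨hP, fun hu => h1 (hu ▸ Set.mem_univ _), fun A B _ hB hAB => ?_⟩
  by_contra! hcon
  obtain ⟨a, ha, haP⟩ := Set.not_subset.1 hcon.1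
  obtain ⟨b, hb, hbP⟩ := Set.not_subset.1 hcon.2
  rcases h a b fun r => by
    simpa [mul_assoc] using hAB a ha _ (hB.2.2.2 b hb r).1 with h | h
  exacts [haP h, hbP h]

theorem isIdealSet_sInter {R : Type*} [Ring R] {c : Set (Set R)} (hc : ∀ P ∈ c, IsIdealSet P) :
    IsIdealSet (⋂₀ c) :=
  ⟨fun P hP => (hc P hP).1, fun a ha b hb P hP => (hc P hP).2.1 a (ha P hP) b (hb P hP),
    fun a ha P hP => (hc P hP).2.2.1 a (ha P hP),
    fun a ha r => ⟨fun P hP => ((hc P hP).2.2.2 a (ha P hP) r).1,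
      fun P hP => ((hc P hP).2.2.2 a (ha P hP) r).2⟩⟩

theorem isPrimeIdealSet_sInter_of_isChain {R : Type*} [Ring R] {c : Set (Set R)}
    (hc : ∀ P ∈ c, IsPrimeIdealSet P) (hchain : IsChain (· ⊆ ·) c) (hne : c.Nonempty) :
    IsPrimeIdealSet (⋂₀ c) := by
  refine (isIdealSet_sInter fun P hP => (hc P hP).1).isPrimeIdealSet ?_ fun a b hab => ?_
  · obtain ⟨P, hP⟩ := hne
    exact fun h => (hc P hP).one_notMem (h P hP)
  · by_contra! hcon
    simp only [Set.mem_sInter, not_forall] at hcon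
    obtain ⟨⟨P, hP, haP⟩, Q, hQ, hbQ⟩ := hcon
    rcases hchain.total hP hQ with hle | hle
    · rcases (hc P hP).mem_or_mem fun r => hab r P hP with h | h
      exacts [haP h, hbQ (hle h)]
    · rcases (hc Q hQ).mem_or_mem fun r => hab r Q hQ with h | h
      exacts [haP (hle h), hbQ h]

theorem IsPrimeIdealSet.exists_isMinimalPrimeOver_subset {R : Type*} [Ring R] {A P : Set R}
    (hP : IsPrimeIdealSet P) (hAP : A ⊆ P) : ∃ Q, IsMinimalPrimeOver A Q ∧ Q ⊆ P := by
  obtain ⟨Q, hQP, hQ⟩ := zorn_superset_nonempty {Q : Set R | IsPrimeIdealSet Q ∧ A ⊆ Q}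
    (fun c hc hchain hne => ⟨⋂₀ c,
      ⟨isPrimeIdealSet_sInter_of_isChain (fun Q hQ => (hc hQ).1) hchain hne,
        Set.subset_sInter fun Q hQ => (hc hQ).2⟩,
      fun Q hQ => Set.sInter_subset_of_mem hQ⟩) P ⟨hP, hAP⟩
  exact ⟨Q, ⟨hQ.prop.1, hQ.prop.2, fun P' hP' hA hle =>
    hle.antisymm (hQ.le_of_le ⟨hP', hA⟩ hle)⟩, hQP⟩

theorem IsPrimeIdealSet.exists_subset_of_prod_mem {R : Type*} [Ring R] {Q : Set R}
    (hQ : IsPrimeIdealSet Q) {n : ℕ} {P : Fin n → Set R} (hP : ∀ i, IsIdealSet (P i))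
    (h : ∀ x : Fin n → R, (∀ i, x i ∈ P i) → (List.ofFn x).prod ∈ Q) : ∃ i, P i ⊆ Q := by
  by_contra! hcon
  suffices ∃ x : Fin n → R, (∀ i, x i ∈ P i) ∧ (List.ofFn x).prod ∉ Q by
    obtain ⟨x, hx, hxQ⟩ := this
    exact hxQ (h x hx)
  clear h
  induction n with
  | zero => exact ⟨Fin.elim0, fun i => i.elim0, by simpa using hQ.one_notMem⟩
  | succ n ih =>
    obtain ⟨x, hx, hxQ⟩ := ih (fun i => hP i.succ) fun i => hcon i.succ
    obtain ⟨a, ha, haQ⟩ := Set.not_subset.1 (hcon 0)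
    obtain ⟨r, hr⟩ : ∃ r, a * r * (List.ofFn x).prod ∉ Q := by
      by_contra! hall
      exact (hQ.mem_or_mem hall).elim haQ hxQ
    refine ⟨Fin.cons (a * r) x, Fin.cases ((hP 0).2.2.2 a ha r).2 hx, ?_⟩
    simpa [List.ofFn_succ] using hr

theorem IsIdealSet.prod_mem {R : Type*} [Ring R] {A : Set R} (hA : IsIdealSet A) {l : List R}
    {a : R} (ha : a ∈ l) (haA : a ∈ A) : l.prod ∈ A := by
  obtain ⟨s, t, rfl⟩ := List.append_of_mem ha
  simpa [mul_assoc] using (hA.2.2.2 _ (hA.2.2.2 a haA t.prod).2 s.prod).1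

/-- A ring is prime rich exactly when every ideal contains a finite product of primes that are
minimal over it. -/
theorem isPrimeRich_iff_exists_isMinimalPrimeOver {R : Type*} [Ring R] :
    IsPrimeRich R ↔
      ∀ A : Set R, IsIdealSet A →
        ∃ (n : ℕ) (P : Fin n → Set R),
          (∀ i, IsMinimalPrimeOver A (P i)) ∧
          ∀ x : Fin n → R, (∀ i, x i ∈ P i) → (List.ofFn x).prod ∈ A := by
  refine forall₂_congr fun A _ => ⟨?_, ?_⟩
  · rintro ⟨n, P, hP, hprod⟩
    choose Q hQ hQP using fun i => (hP i).1.exists_isMinimalPrimeOver_subset (hP i).2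
    exact ⟨n, Q, hQ, fun x hx => hprod x fun i => hQP i (hx i)⟩
  · rintro ⟨n, P, hP, hprod⟩
    exact ⟨n, P, fun i => ⟨(hP i).1, (hP i).2.1⟩, hprod⟩

/-- An ideal contains a finite product of its minimal primes exactly when it has finitely many of
them and the prime radical modulo the ideal is nilpotent. -/
theorem IsIdealSet.exists_prod_isMinimalPrimeOver_iff {R : Type*} [Ring R] {A : Set R}
    (hA : IsIdealSet A) :
    (∃ (n : ℕ) (P : Fin n → Set R),
      (∀ i, IsMinimalPrimeOver A (P i)) ∧
      ∀ x : Fin n → R, (∀ i, x i ∈ P i) → (List.ofFn x).prod ∈ A) ↔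
    {P : Set R | IsMinimalPrimeOver A P}.Finite ∧
      ∃ k : ℕ, 1 ≤ k ∧
        ∀ x : Fin k → R,
          (∀ i, x i ∈ {r : R | ∀ P : Set R, IsPrimeIdealSet P → A ⊆ P → r ∈ P}) →
          (List.ofFn x).prod ∈ A := by
  constructor
  · rintro ⟨n, P, hP, hprod⟩
    refine ⟨(Set.finite_range P).subset fun Q hQ => ?_, n + 1, by omega, fun x hx => ?_⟩
    · obtain ⟨i, hi⟩ := hQ.1.exists_subset_of_prod_mem (fun i => (hP i).1.1)
        fun x hx => hQ.2.1 (hprod x hx)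
      exact ⟨i, hQ.2.2 _ (hP i).1 (hP i).2.1 hi⟩
    · rw [List.ofFn_succ, List.prod_cons]
      exact (hA.2.2.2 _ (hprod _ fun i => hx _ _ (hP i).1 (hP i).2.1) _).1
  · rintro ⟨hfin, k, -, hk⟩
    obtain ⟨n, p, -, hp⟩ := hfin.fin_param
    have hmin : ∀ j, IsMinimalPrimeOver A (p j) := fun j => by
      have : p j ∈ {P : Set R | IsMinimalPrimeOver A P} := hp ▸ Set.mem_range_self j
      exact this
    refine ⟨k * n, fun i => p i.modNat, fun i => hmin _, fun x hx => ?_⟩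
    rw [List.ofFn_mul, List.prod_flatten, List.map_ofFn]
    refine hk _ fun i Q hQ hAQ => ?_
    obtain ⟨Q', hQ', hle⟩ := hQ.exists_isMinimalPrimeOver_subset hAQ
    obtain ⟨j, rfl⟩ : Q' ∈ Set.range p := hp ▸ hQ'
    refine hQ.1.prod_mem ((List.mem_ofFn' _ _).2 ⟨j, rfl⟩) (hle ?_)
    convert hx _
    ext
    simp [Fin.modNat, Nat.mod_eq_of_lt j.2]

/-- For a ring `R` the following are equivalent: (1) `R` is prime
rich; (2) every ideal `𝔞` contains a finite product of its minimal primes;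
(3) for every ideal `𝔞`, `min(𝔞)` is finite and the prime radical of `R/𝔞`
is a nilpotent ideal. -/
theorem statement3 {R : Type*} [Ring R] :
    (IsPrimeRich R ↔
      ∀ A : Set R, IsIdealSet A →
        ∃ (n : ℕ) (P : Fin n → Set R),
          (∀ i, IsMinimalPrimeOver A (P i)) ∧
          ∀ x : Fin n → R, (∀ i, x i ∈ P i) → (List.ofFn x).prod ∈ A) ∧
    (IsPrimeRich R ↔
      ∀ A : Set R, IsIdealSet A →
        {P : Set R | IsMinimalPrimeOver A P}.Finite ∧
        ∃ k : ℕ, 1 ≤ k ∧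
          ∀ x : Fin k → R,
            (∀ i, x i ∈ {r : R | ∀ P : Set R, IsPrimeIdealSet P → A ⊆ P → r ∈ P}) →
            (List.ofFn x).prod ∈ A) := by
  have h := isPrimeRich_iff_exists_isMinimalPrimeOver (R := R)
  exact ⟨h, h.trans (forall₂_congr fun A hA => hA.exists_prod_isMinimalPrimeOver_iff)⟩

end BavulaMinPrimes
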